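/- Let n ≥ 2 and let θ* ∈ ℝ^n be defined by θ*_i = 0 for i < ⌈n/2⌉ and θ*_i = 1 for i ≥ ⌈n/2⌉. Let θ̂^{(1)}_{V=1} denote the constrained trend filtering estimator of order r = 1 with tuning parameter V = 1. Then lim inf as σ ↓ 0 of (1/σ²)·R(θ̂^{(1)}_{V=1}, θ*) ≥ log(n/2)/(2n). -/

import Mathlib

open MeasureTheory ProbabilityTheory
open scoped BigOperators

noncomputable section

/-- Zero-padding of a finite vector to a sequence on `ℕ`. -/
def pad {n : ℕ} (θ : Fin n → ℝ) : ℕ → ℝ := fun t => if h : t < n then θ ⟨t, h⟩ else 0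

/-- First-order forward difference of a sequence. -/
def dseq (f : ℕ → ℝ) : ℕ → ℝ := fun t => f (t + 1) - f t

/-- `DD r θ t` is the `t`-th entry (0-indexed) of the `r`-th order difference `D^{(r)} θ`
of the vector `θ ∈ ℝ^n`; only the entries `t < n - r` are meaningful. -/
def DD (r : ℕ) {n : ℕ} (θ : Fin n → ℝ) : ℕ → ℝ := dseq^[r] (pad θ)

/-- The ℓ¹ norm `‖D^{(r)} θ‖₁`. -/
def Dl1 (r : ℕ) {n : ℕ} (θ : Fin n → ℝ) : ℝ := ∑ t ∈ Finset.range (n - r), |DD r θ t|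

/-- The number of nonzero entries `‖D^{(r)} θ‖₀`. -/
def Dl0 (r : ℕ) {n : ℕ} (θ : Fin n → ℝ) : ℕ :=
  ((Finset.range (n - r)).filter fun t => DD r θ t ≠ 0).card

/-- Squared Euclidean norm. -/
def sqnorm {n : ℕ} (x : Fin n → ℝ) : ℝ := ∑ i, x i ^ 2

/-- Euclidean norm. -/
def eunorm {n : ℕ} (x : Fin n → ℝ) : ℝ := Real.sqrt (sqnorm x)

/-- `V^{(r)}(θ) = n^{r-1} ‖D^{(r)} θ‖₁`. -/
def Vr (r : ℕ) {n : ℕ} (θ : Fin n → ℝ) : ℝ := (n : ℝ) ^ ((r : ℤ) - 1) * Dl1 r θ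

/-- The constraint set `K^{(r)}(V) = {θ : ‖D^{(r)} θ‖₁ ≤ V n^{1-r}}`. -/
def Kset (r n : ℕ) (V : ℝ) : Set (Fin n → ℝ) := {θ | Dl1 r θ ≤ V * (n : ℝ) ^ (1 - (r : ℤ))}

/-- `est` is a least-squares projection onto the set `K`. -/
def IsProjOn {n : ℕ} (est : (Fin n → ℝ) → Fin n → ℝ) (K : Set (Fin n → ℝ)) : Prop :=
  ∀ y, est y ∈ K ∧ ∀ θ ∈ K, sqnorm (y - est y) ≤ sqnorm (y - θ)

/-- `est` is the penalized trend filtering estimator of order `r` with noise level `σ`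
and tuning parameter `lam`: it minimizes `½‖y - θ‖² + σ n^{r-1} lam ‖D^{(r)} θ‖₁`. -/
def IsPenEst (r : ℕ) {n : ℕ} (σ lam : ℝ) (est : (Fin n → ℝ) → Fin n → ℝ) : Prop :=
  ∀ y θ, 1 / 2 * sqnorm (y - est y) + σ * (n : ℝ) ^ ((r : ℤ) - 1) * lam * Dl1 r (est y) ≤
    1 / 2 * sqnorm (y - θ) + σ * (n : ℝ) ^ ((r : ℤ) - 1) * lam * Dl1 r θ

/-- The Gaussian measure `N_n(0, σ² I_n)` on `ℝ^n`. -/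
def gaussVec (n : ℕ) (σ : ℝ) : Measure (Fin n → ℝ) :=
  Measure.pi fun _ => gaussianReal 0 (σ ^ 2).toNNReal

/-- The risk `R(θ̂, θ*) = (1/n) E ‖θ̂(θ* + ξ) - θ*‖²` for `ξ ∼ N_n(0, σ² I_n)`. -/
def risk {n : ℕ} (σ : ℝ) (est : (Fin n → ℝ) → Fin n → ℝ) (θs : Fin n → ℝ) : ℝ :=
  1 / (n : ℝ) * ∫ ξ, sqnorm (est (θs + ξ) - θs) ∂gaussVec n σ

/-- `j` (with signs `sg`) enumerates, in increasing order and paper (1-indexed) convention,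
exactly the `r`-th order knots of `θ ∈ ℝ^n`; an index `2 ≤ m ≤ n - r + 1` is a knot when
`(D^{(r-1)}θ)_{m-1} ≠ (D^{(r-1)}θ)_m` (1-indexed entries), and its sign is `+1` when
`(D^{(r-1)}θ)_{m-1} < (D^{(r-1)}θ)_m` and `-1` otherwise. -/
def IsKnotSeq (r n : ℕ) (θ : Fin n → ℝ) (k : ℕ) (j : Fin k → ℕ) (sg : Fin k → ℝ) : Prop :=
  StrictMono j ∧ (∀ i, 2 ≤ j i ∧ j i ≤ n - r + 1) ∧
    (∀ m : ℕ, 2 ≤ m → m ≤ n - r + 1 →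
      (DD (r - 1) θ (m - 2) ≠ DD (r - 1) θ (m - 1) ↔ ∃ i, j i = m)) ∧
    ∀ i, sg i = if DD (r - 1) θ (j i - 2) < DD (r - 1) θ (j i - 1) then 1 else -1

/-- Extended knot sequence: `jext 0 = j_0 = 1`, `jext i = j_i` for `1 ≤ i ≤ k`, and
`jext (k+1) = j_{k+1} = n - r + 2`. -/
def jext (n r k : ℕ) (j : Fin k → ℕ) : ℕ → ℕ := fun i =>
  if i = 0 then 1 else if h : i - 1 < k then j ⟨i - 1, h⟩ else n - r + 2

/-- Extended sign sequence: `sgext i = 𝔯_i` for `1 ≤ i ≤ k` and `0` otherwise. -/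
def sgext (k : ℕ) (sg : Fin k → ℝ) : ℕ → ℝ := fun i =>
  if h : 0 < i ∧ i - 1 < k then sg ⟨i - 1, h.2⟩ else 0

/-- The lengths `n_0 = j_1 + r - 2`, `n_i = j_{i+1} - j_i` (`1 ≤ i ≤ k-1`),
`n_k = n - r + 2 - j_k`. -/
def nlen (n r k : ℕ) (j : Fin k → ℕ) : ℕ → ℕ := fun i =>
  if i = 0 then jext n r k j 1 + r - 2 else jext n r k j (i + 1) - jext n r k j i

/-- `n_{i*} = min(n_i, n/(k+1))`. -/
def nstar (n r k : ℕ) (j : Fin k → ℕ) (i : ℕ) : ℝ :=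
  min (nlen n r k j i : ℝ) ((n : ℝ) / ((k : ℝ) + 1))

/-- `δ_r(θ)²` defined from the knot data of `θ`. -/
def deltaSq (n r k : ℕ) (j : Fin k → ℕ) (sg : Fin k → ℝ) : ℝ :=
  nstar n r k j 0 ^ (1 - 2 * (r : ℤ)) + nstar n r k j k ^ (1 - 2 * (r : ℤ)) +
    ∑ i ∈ Finset.Ico 1 k,
      if sgext k sg i ≠ sgext k sg (i + 1) then nstar n r k j i ^ (1 - 2 * (r : ℤ)) else 0

/-- `Δ_r(θ)` defined from the knot data of `θ`. -/
def DeltaR (n r k : ℕ) (j : Fin k → ℕ) (sg : Fin k → ℝ) : ℝ :=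
  ((k : ℝ) + 1) / (n : ℝ) * Real.log (Real.exp 1 * (n : ℝ) / ((k : ℝ) + 1)) +
    deltaSq n r k j sg / (n : ℝ) * ((n : ℝ) / ((k : ℝ) + 1)) ^ (2 * (r : ℤ) - 1) *
      Real.log (Real.exp 1 * (n : ℝ) / ((k : ℝ) + 1)) +
    (Real.sqrt (deltaSq n r k j sg) / Real.sqrt (n : ℝ)) ^ ((1 : ℝ) / (r : ℝ))

/-- The minimum length condition with constant `c`: `n_i ≥ c n/(k+1)` for every `0 ≤ i ≤ k`
with `𝔯_i ≠ 𝔯_{i+1}` (where `𝔯_0 = 𝔯_{k+1} = 0`). -/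
def MinLen (n r k : ℕ) (j : Fin k → ℕ) (sg : Fin k → ℝ) (c : ℝ) : Prop :=
  ∀ i ≤ k, sgext k sg i ≠ sgext k sg (i + 1) →
    c * (n : ℝ) / ((k : ℝ) + 1) ≤ (nlen n r k j i : ℝ)

/-- The subdifferential of `g` at `θ`. -/
def subdiff {n : ℕ} (g : (Fin n → ℝ) → ℝ) (θ : Fin n → ℝ) : Set (Fin n → ℝ) :=
  {v | ∀ y, g θ + ∑ i, v i * (y i - θ i) ≤ g y}

/-- `v` is the minimum-norm element of `S`. -/
def IsMinNormIn {n : ℕ} (v : Fin n → ℝ) (S : Set (Fin n → ℝ)) : Prop :=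
  v ∈ S ∧ ∀ w ∈ S, eunorm v ≤ eunorm w

/-- `c • S`. -/
def scaleSet {n : ℕ} (c : ℝ) (S : Set (Fin n → ℝ)) : Set (Fin n → ℝ) := (c • ·) '' S

/-- The cone generated by `S`: `⋃_{c ≥ 0} c • S`. -/
def coneOf {n : ℕ} (S : Set (Fin n → ℝ)) : Set (Fin n → ℝ) := ⋃ c ∈ Set.Ici (0 : ℝ), scaleSet c S

/-- Euclidean distance from a point to a set. -/
def distSet {n : ℕ} (z : Fin n → ℝ) (S : Set (Fin n → ℝ)) : ℝ :=
  sInf ((fun v => eunorm (z - v)) '' S)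

/-- Gaussian mean squared distance `D(S) = E dist²(Z, S)`, `Z ∼ N_n(0, I_n)`. -/
def gaussMSD {n : ℕ} (S : Set (Fin n → ℝ)) : ℝ := ∫ z, distSet z S ^ 2 ∂gaussVec n 1

/-- `lam z` is, for each `z`, the minimizer over `λ ≥ 0` of `dist(z, λ S)`. -/
def IsLamFun {n : ℕ} (S : Set (Fin n → ℝ)) (lam : (Fin n → ℝ) → ℝ) : Prop :=
  ∀ z, 0 ≤ lam z ∧ ∀ μ : ℝ, 0 ≤ μ → distSet z (scaleSet (lam z) S) ≤ distSet z (scaleSet μ S)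

/-- Euclidean covering number of `K` at scale `ε`. -/
def covN {n : ℕ} (ε : ℝ) (K : Set (Fin n → ℝ)) : ℕ :=
  sInf {m : ℕ | ∃ a : Fin m → Fin n → ℝ, ∀ x ∈ K, ∃ i, eunorm (x - a i) ≤ ε}

/-- `K` `t`-shatters the (finite) index set `A`. -/
def fatShatters {n : ℕ} (K : Set (Fin n → ℝ)) (t : ℝ) (A : Finset (Fin n)) : Prop :=
  ∃ h : Fin n → ℝ, ∀ S : Finset (Fin n), S ⊆ A →
    ∃ θ ∈ K, (∀ i ∈ S, θ i ≤ h i) ∧ ∀ i ∈ A, i ∉ S → h i + t ≤ θ i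

/-- The fat shattering dimension `v(K, t)`. -/
def fatDim {n : ℕ} (K : Set (Fin n → ℝ)) (t : ℝ) : ℕ :=
  sSup {m : ℕ | ∃ A : Finset (Fin n), A.card = m ∧ fatShatters K t A}

/-- The tangent cone of `K` at `θ`. -/
def tanCone {n : ℕ} (K : Set (Fin n → ℝ)) (θ : Fin n → ℝ) : Set (Fin n → ℝ) :=
  closure {w | ∃ t : ℝ, 0 ≤ t ∧ ∃ η ∈ K, w = t • (η - θ)}

/-- `V_{a,b}(f) = Σ_{m=a+1}^{b} |f_m - f_{m-1}|` for the (paper 1-indexed) sequence whose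
`m`-th entry is `f (m-1)`. -/
def Vab (f : ℕ → ℝ) (a b : ℕ) : ℝ := ∑ t ∈ Finset.Ico (a - 1) (b - 1), |f (t + 1) - f t|

/-- `Acoef r n v j = Σ_{i=j}^n C(r+i-j-1, r-1) v_i` (paper 1-indexed). -/
def Acoef (r n : ℕ) (v : Fin n → ℝ) (jj : ℕ) : ℝ :=
  ∑ i : Fin n, (if jj ≤ i.1 + 1 then ((r + (i.1 + 1) - jj - 1).choose (r - 1) : ℝ) else 0) * v i

/-- The class `C_r({a_i}, {s_i})`. -/
def Cras (r n : ℕ) (a s : ℕ → ℝ) : Set (Fin n → ℝ) :=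
  {θ | (∀ i < r - 1, a i ≤ DD i θ 0 ∧ DD i θ 0 ≤ a i + s i) ∧
    a (r - 1) ≤ DD (r - 1) θ 0 ∧
    (∀ t : ℕ, t + 1 ≤ n - r → DD (r - 1) θ t ≤ DD (r - 1) θ (t + 1)) ∧
    DD (r - 1) θ (n - r) ≤ a (r - 1) + s (r - 1)}

/-- The class `C_r(a, V) = {θ : a ≤ (D^{(r-1)}θ)_1 ≤ ⋯ ≤ (D^{(r-1)}θ)_{n-r+1} ≤ a + V}`. -/
def CrMono (r n : ℕ) (a V : ℝ) : Set (Fin n → ℝ) :=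
  {θ | a ≤ DD (r - 1) θ 0 ∧
    (∀ t : ℕ, t + 1 ≤ n - r → DD (r - 1) θ t ≤ DD (r - 1) θ (t + 1)) ∧
    DD (r - 1) θ (n - r) ≤ a + V}


/-- Running maximum `max(0, S_1, ..., S_j)` of the partial sums of `f`. -/
def Mx : ℕ → (ℕ → ℝ) → ℝ
  | 0, _ => 0
  | j + 1, f => max 0 (f 0 + Mx j (fun i => f (i + 1)))

lemma Mx_nonneg (j : ℕ) (f : ℕ → ℝ) : 0 ≤ Mx j f := by
  cases j with
  | zero => simp [Mx]
  | succ j => simp [Mx]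

lemma Mx_le_succ (j : ℕ) : ∀ f : ℕ → ℝ, Mx j f ≤ Mx (j + 1) f := by
  induction j with
  | zero => intro f; exact Mx_nonneg 1 f
  | succ j ih =>
    intro f
    rw [Mx, Mx]
    exact max_le_max le_rfl (by linarith [ih (fun i => f (i + 1))])

lemma Mx_shift_le (j : ℕ) (f : ℕ → ℝ) : f 0 + Mx j (fun i => f (i + 1)) ≤ Mx (j + 1) f := by
  rw [Mx]; exact le_max_right _ _

lemma Mx_le (j : ℕ) : ∀ (f : ℕ → ℝ) (B : ℝ),
    (∀ i ≤ j, ∑ t ∈ Finset.range i, f t ≤ B) → Mx j f ≤ B := by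
  induction j with
  | zero => intro f B h; simpa [Mx] using h 0 le_rfl
  | succ j ih =>
    intro f B h
    rw [Mx]
    refine max_le (by simpa using h 0 (Nat.zero_le _)) ?_
    have := ih (fun i => f (i + 1)) (B - f 0) (fun i hi => by
      have := h (i + 1) (by omega)
      rw [Finset.sum_range_succ'] at this
      linarith)
    linarith

lemma Mx_congr (j : ℕ) : ∀ (f g : ℕ → ℝ), (∀ i < j, f i = g i) → Mx j f = Mx j g := by
  induction j with
  | zero => intro f g _; rfl
  | succ j ih =>
    intro f g h
    rw [Mx, Mx, h 0 (by omega), ih _ (fun i => g (i + 1)) (fun i hi => h (i + 1) (by omega))]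

lemma Mx_le_abs (j : ℕ) (f : ℕ → ℝ) : Mx j f ≤ ∑ t ∈ Finset.range j, |f t| := by
  refine Mx_le j f _ fun i hi => ?_
  calc ∑ t ∈ Finset.range i, f t ≤ ∑ t ∈ Finset.range i, |f t| :=
        Finset.sum_le_sum fun t _ => le_abs_self _
    _ ≤ _ := Finset.sum_le_sum_of_subset_of_nonneg (by simpa using hi) (fun _ _ _ => abs_nonneg _)

lemma Mx_continuous {X : Type*} [TopologicalSpace X] (j : ℕ) : ∀ (f : X → ℕ → ℝ),
    (∀ i, Continuous fun x => f x i) → Continuous fun x => Mx j (f x) := by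
  induction j with
  | zero => intro f _; simp only [Mx]; exact continuous_const
  | succ j ih =>
    intro f h
    simp only [Mx]
    exact continuous_const.max ((h 0).add (ih (fun x i => f x (i + 1)) (fun i => h (i + 1))))

/-- The block sequence. -/
def ff {n : ℕ} (m : ℕ) (c : ℝ) (z : Fin n → ℝ) : ℕ → ℝ := fun i => -pad z (m + i) - c

lemma pad_continuous {n : ℕ} (i : ℕ) : Continuous fun z : Fin n → ℝ => pad z i := by
  unfold pad
  split_ifs with h
  · exact continuous_apply _
  · exact continuous_const

lemma ff_continuous {n : ℕ} (m i : ℕ) :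
    Continuous fun p : (Fin n → ℝ) × ℝ => ff m p.2 p.1 i := by
  unfold ff
  exact (((pad_continuous (m + i)).comp continuous_fst).neg).sub continuous_snd

lemma ff_continuous' {n : ℕ} (m i : ℕ) (c : ℝ) :
    Continuous fun z : (Fin n → ℝ) => ff m c z i := by
  unfold ff
  exact ((pad_continuous (m + i)).neg).sub continuous_const

instance gaussVec_prob (n : ℕ) (σ : ℝ) : IsProbabilityMeasure (gaussVec n σ) := by
  unfold gaussVec; infer_instance

lemma memLp_pad {n : ℕ} (i : ℕ) : MemLp (fun z : Fin n → ℝ => pad z i) 2 (gaussVec n 1) := by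
  unfold pad
  split_ifs with h
  · exact (memLp_id_gaussianReal' (μ := 0) (v := ((1:ℝ) ^ 2).toNNReal) 2
      (by norm_num)).comp_measurePreserving (measurePreserving_eval
        (fun _ : Fin n => gaussianReal 0 ((1:ℝ) ^ 2).toNNReal) ⟨i, h⟩)
  · exact memLp_const 0

lemma integrable_pad {n : ℕ} (i : ℕ) : Integrable (fun z : Fin n → ℝ => pad z i) (gaussVec n 1) :=
  (memLp_pad i).integrable (by norm_num)

lemma integrable_ff {n : ℕ} (m i : ℕ) (c : ℝ) :
    Integrable (fun z : Fin n → ℝ => ff m c z i) (gaussVec n 1) :=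
  ((integrable_pad (m + i)).neg).sub (integrable_const c)

lemma integrable_Mx {n : ℕ} (m j : ℕ) (c : ℝ) (s : ℕ) :
    Integrable (fun z : Fin n → ℝ => Mx j (fun i => ff m c z (i + s))) (gaussVec n 1) := by
  refine Integrable.mono' (g := fun z => ∑ t ∈ Finset.range j, |ff m c z (t + s)|) ?_ ?_ ?_
  · exact integrable_finsetSum _ fun t _ => (integrable_ff m (t + s) c).abs
  · exact (Mx_continuous j _ fun i => ff_continuous' m (i + s) c).aestronglyMeasurable
  · filter_upwards with z
    rw [Real.norm_eq_abs, abs_of_nonneg (Mx_nonneg _ _)]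
    exact Mx_le_abs j _

lemma gauss_perm {n : ℕ} (e : Equiv.Perm (Fin n)) (F : (Fin n → ℝ) → ℝ) :
    ∫ z, F (fun i => z (e i)) ∂gaussVec n 1 = ∫ z, F z ∂gaussVec n 1 := by
  have h := measurePreserving_piCongrLeft
    (fun _ : Fin n => gaussianReal 0 ((1:ℝ) ^ 2).toNNReal) e.symm
  have h2 := h.integral_comp' F
  unfold gaussVec
  rw [← h2]
  congr 1
  funext z
  congr 1
  funext i
  have := MeasurableEquiv.piCongrLeft_apply_apply (β := fun _ : Fin n => ℝ) (e := e.symm) z (e i)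
  simpa using this.symm

lemma exists_rot (n m k : ℕ) (h : m + k < n) : ∃ e : Equiv.Perm (Fin n), ∀ (z : Fin n → ℝ),
    (∀ i < k, pad (fun i => z (e i)) (m + i) = pad z (m + i + 1)) ∧
      pad (fun i => z (e i)) (m + k) = pad z m := by
  let g : Fin n → Fin n := fun i =>
    if h1 : m ≤ i.1 ∧ i.1 < m + k then ⟨i.1 + 1, by omega⟩ else
      if i.1 = m + k then ⟨m, by omega⟩ else i
  have hg : Function.Injective g := by
    intro a b hab
    have hv : (g a).1 = (g b).1 := by rw [hab]
    simp only [g] at hv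
    ext
    split_ifs at hv <;> (try simp at hv) <;> omega
  refine ⟨Equiv.ofBijective g (Finite.injective_iff_bijective.mp hg), fun z => ⟨?_, ?_⟩⟩
  · intro i hi
    simp only [pad, Equiv.ofBijective_apply]
    rw [dif_pos (by omega), dif_pos (by omega)]
    simp [g, hi]
  · simp only [pad, Equiv.ofBijective_apply]
    rw [dif_pos (by omega), dif_pos (by omega)]
    simp [g]

lemma spitzer_step {n : ℕ} (m k : ℕ) (c : ℝ) (h : m + k < n) :
    ∫ z, Mx k (ff m c z) ∂gaussVec n 1 + 1 / ((k : ℝ) + 1) *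
      ∫ z, max (∑ i ∈ Finset.range (k + 1), ff m c z i) 0 ∂gaussVec n 1 ≤
    ∫ z, Mx (k + 1) (ff m c z) ∂gaussVec n 1 := by
  obtain ⟨e, he⟩ := exists_rot n m k h
  have hff1 : ∀ z : Fin n → ℝ, ∀ i < k, ff m c (fun i => z (e i)) i = ff m c z (i + 1) := by
    intro z i hi
    simp only [ff]; rw [(he z).1 i hi]; rfl
  have hff2 : ∀ z : Fin n → ℝ, ff m c (fun i => z (e i)) k = ff m c z 0 := by
    intro z
    simp only [ff]; rw [(he z).2]; rfl
  set S : (Fin n → ℝ) → ℝ := fun z => ∑ i ∈ Finset.range (k + 1), ff m c z i with hS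
  have hScont : Continuous S := continuous_finsetSum _ fun i _ => ff_continuous' m i c
  have hSe : ∀ z, S (fun i => z (e i)) = S z := by
    intro z
    simp only [hS]
    rw [Finset.sum_range_succ, Finset.sum_range_succ', hff2]
    congr 1
    exact Finset.sum_congr rfl fun i hi => hff1 z i (Finset.mem_range.mp hi)
  set A : Set (Fin n → ℝ) := {z | 0 < S z} with hA
  have hAm : MeasurableSet A := measurableSet_lt measurable_const hScont.measurable
  have hAe : ∀ z : Fin n → ℝ, (fun i => z (e i)) ∈ A ↔ z ∈ A := by
    intro z; change 0 < S _ ↔ 0 < S z; rw [hSe]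
  -- first coordinate
  have hrot : ∀ i ≤ k, ∫ z, A.indicator (fun z => ff m c z i) z ∂gaussVec n 1 =
      ∫ z, A.indicator (fun z => ff m c z 0) z ∂gaussVec n 1 := by
    intro i
    induction i with
    | zero => intro _; rfl
    | succ i ih =>
      intro hi
      rw [← ih (by omega), ← gauss_perm e (fun z => A.indicator (fun z => ff m c z i) z)]
      congr 1
      funext z
      by_cases hz : z ∈ A
      · rw [Set.indicator_of_mem hz, Set.indicator_of_mem ((hAe z).2 hz), hff1 z i (by omega)]
      · rw [Set.indicator_of_notMem hz, Set.indicator_of_notMem (fun h => hz ((hAe z).1 h))]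
  have hsum : ∫ z, max (S z) 0 ∂gaussVec n 1 =
      ((k : ℝ) + 1) * ∫ z, A.indicator (fun z => ff m c z 0) z ∂gaussVec n 1 := by
    have h1 : ∀ z, max (S z) 0 =
        ∑ i ∈ Finset.range (k + 1), A.indicator (fun z => ff m c z i) z := by
      intro z
      by_cases hz : z ∈ A
      · rw [max_eq_left (le_of_lt hz)]
        simp only [hS]
        exact Finset.sum_congr rfl fun i _ => by rw [Set.indicator_of_mem hz]
      · rw [max_eq_right (not_lt.mp hz)]
        symm
        exact Finset.sum_eq_zero fun i _ => Set.indicator_of_notMem hz _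
    simp_rw [h1]
    rw [integral_finsetSum _ fun i _ => (integrable_ff m i c).indicator hAm,
      Finset.sum_congr rfl fun i hi => hrot i (by have := Finset.mem_range.mp hi; omega)]
    simp
  have hM : ∫ z, A.indicator (fun z => Mx k (fun i => ff m c z (i + 1))) z ∂gaussVec n 1 =
      ∫ z, A.indicator (fun z => Mx k (ff m c z)) z ∂gaussVec n 1 := by
    rw [← gauss_perm e (fun z => A.indicator (fun z => Mx k (ff m c z)) z)]
    congr 1
    funext z
    by_cases hz : z ∈ A
    · rw [Set.indicator_of_mem hz, Set.indicator_of_mem ((hAe z).2 hz)]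
      exact Mx_congr k _ _ fun i hi => (hff1 z i hi).symm
    · rw [Set.indicator_of_notMem hz, Set.indicator_of_notMem (fun h => hz ((hAe z).1 h))]
  have i0 := (integrable_ff (n := n) m 0 c).indicator hAm
  have i1 := (integrable_Mx (n := n) m k c 1).indicator hAm
  have i2 := (integrable_Mx (n := n) m k c 0).indicator hAm.compl
  have i3 := (integrable_Mx (n := n) m k c 0).indicator hAm
  simp only [add_zero] at i2 i3
  have hsplit : ∫ z, Mx k (ff m c z) ∂gaussVec n 1 =
      ∫ z, A.indicator (fun z => Mx k (ff m c z)) z ∂gaussVec n 1 +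
      ∫ z, Aᶜ.indicator (fun z => Mx k (ff m c z)) z ∂gaussVec n 1 := by
    rw [← integral_add i3 i2]
    congr 1
    funext z
    exact (congrFun (Set.indicator_self_add_compl A (fun z => Mx k (ff m c z))) z).symm
  have hle : ∫ z, (A.indicator (fun z => ff m c z 0) z +
      A.indicator (fun z => Mx k (fun i => ff m c z (i + 1))) z) +
      Aᶜ.indicator (fun z => Mx k (ff m c z)) z ∂gaussVec n 1 ≤
      ∫ z, Mx (k + 1) (ff m c z) ∂gaussVec n 1 := by
    refine integral_mono ((i0.add i1).add i2) (integrable_Mx m (k + 1) c 0) fun z => ?_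
    by_cases hz : z ∈ A
    · have hz' : z ∉ Aᶜ := fun h => h hz
      simp only [Set.indicator_of_mem hz, Set.indicator_of_notMem hz', add_zero]
      exact Mx_shift_le k _
    · have hz' : z ∈ Aᶜ := hz
      simp only [Set.indicator_of_mem hz', Set.indicator_of_notMem hz, zero_add]
      exact Mx_le_succ k _
  have hadd : ∫ z, (A.indicator (fun z => ff m c z 0) z +
      A.indicator (fun z => Mx k (fun i => ff m c z (i + 1))) z) +
      Aᶜ.indicator (fun z => Mx k (ff m c z)) z ∂gaussVec n 1 =
      (∫ z, A.indicator (fun z => ff m c z 0) z ∂gaussVec n 1 +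
      ∫ z, A.indicator (fun z => Mx k (fun i => ff m c z (i + 1))) z ∂gaussVec n 1) +
      ∫ z, Aᶜ.indicator (fun z => Mx k (ff m c z)) z ∂gaussVec n 1 := by
    refine (integral_add (i0.add i1) i2).trans ?_
    congr 1
    exact integral_add i0 i1
  rw [hadd, hM] at hle
  rw [hsplit, hsum, ← mul_assoc, one_div, inv_mul_cancel₀ (by positivity), one_mul]
  linarith

lemma spitzer {n : ℕ} (m k : ℕ) (c : ℝ) (h : m + k ≤ n) :
    ∑ j ∈ Finset.range k, 1 / ((j : ℝ) + 1) *
      ∫ z, max (∑ i ∈ Finset.range (j + 1), ff m c z i) 0 ∂gaussVec n 1 ≤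
    ∫ z, Mx k (ff m c z) ∂gaussVec n 1 := by
  induction k with
  | zero => simp [Mx]
  | succ k ih =>
    rw [Finset.sum_range_succ]
    linarith [ih (by omega), spitzer_step (n := n) m k c (by omega)]

lemma gauss_scale (n : ℕ) (σ : ℝ) :
    gaussVec n σ = (gaussVec n 1).map (fun z i => σ * z i) := by
  unfold gaussVec
  have hm : ∀ i : Fin n, Measure.map (fun x => σ * x) (gaussianReal 0 ((1:ℝ) ^ 2).toNNReal) =
      gaussianReal 0 (σ ^ 2).toNNReal := by
    intro i
    rw [gaussianReal_map_const_mul]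
    congr 1
    · simp
    · ext
      simp [sq_nonneg]
  have : ∀ i : Fin n, SigmaFinite
      (Measure.map (fun x => σ * x) (gaussianReal 0 ((1:ℝ) ^ 2).toNNReal)) := by
    intro i; rw [hm i]; infer_instance
  rw [Measure.pi_map_pi (f := fun (_ : Fin n) x => σ * x) (fun i => by fun_prop)]
  congr 1
  funext i
  exact (hm i).symm

lemma integral_gauss_scale {n : ℕ} (σ : ℝ) (F : (Fin n → ℝ) → ℝ) (hF : Continuous F) :
    ∫ z, F z ∂gaussVec n σ = ∫ z, F (fun i => σ * z i) ∂gaussVec n 1 := by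
  rw [gauss_scale, integral_map (Continuous.aemeasurable (by fun_prop)) hF.aestronglyMeasurable]

lemma hasDerivAt_maxsq (x : ℝ) : HasDerivAt (fun x : ℝ => (max x 0) ^ 2) (2 * max x 0) x := by
  rcases lt_trichotomy x 0 with h | h | h
  · rw [max_eq_right h.le, mul_zero]
    refine (hasDerivAt_const x (0:ℝ)).congr_of_eventuallyEq ?_
    filter_upwards [Iio_mem_nhds h] with y hy
    rw [max_eq_right (le_of_lt hy)]; norm_num
  · subst h
    rw [hasDerivAt_iff_tendsto_slope_zero]
    rw [show 2 * max (0:ℝ) 0 = 0 by simp]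
    refine squeeze_zero_norm' (a := fun t : ℝ => |t|) ?_ ?_
    · filter_upwards with t
      rcases le_total t 0 with ht | ht
      · simp [ht]
      · simp only [zero_add, max_eq_left ht, max_self, smul_eq_mul, Real.norm_eq_abs]
        rcases eq_or_lt_of_le ht with h0 | h0
        · simp [← h0]
        · apply le_of_eq; congr 1; field_simp; ring
    · have : Filter.Tendsto (fun t : ℝ => |t|) (nhds 0) (nhds |0|) := continuous_abs.tendsto 0
      simp only [abs_zero] at this
      simpa using this.mono_left nhdsWithin_le_nhds
  · rw [max_eq_left h.le]
    refine HasDerivAt.congr_of_eventuallyEq (f := fun x => x ^ 2) ?_ ?_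
    · simpa using hasDerivAt_pow 2 x
    · filter_upwards [Ioi_mem_nhds h] with y hy
      rw [max_eq_left (le_of_lt hy)]

lemma integral_max (a s L : ℝ) (ha : 0 < a) :
    ∫ c in (0:ℝ)..L, max (s - a * c) 0 = ((max s 0) ^ 2 - (max (s - a * L) 0) ^ 2) / (2 * a) := by
  have hd : ∀ c ∈ Set.uIcc 0 L, HasDerivAt
      (fun c : ℝ => -((max (s - a * c) 0) ^ 2) / (2 * a)) (max (s - a * c) 0) c := by
    intro c _
    have h1 : HasDerivAt (fun c : ℝ => s - a * c) (-a) c := by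
      simpa using ((hasDerivAt_id c).const_mul a).const_sub s
    have h2 := (((hasDerivAt_maxsq (s - a * c)).comp c h1).neg).div_const (2 * a)
    have h3 : -(2 * max (s - a * c) 0 * -a) / (2 * a) = max (s - a * c) 0 := by
      field_simp
    rw [h3] at h2
    exact h2
  rw [intervalIntegral.integral_eq_sub_of_hasDerivAt hd
    (Continuous.intervalIntegrable (by fun_prop) _ _)]
  simp
  ring

/-- partial sums of the negated block -/
def TT {n : ℕ} (m j : ℕ) (z : Fin n → ℝ) : ℝ := ∑ i ∈ Finset.range (j + 1), -pad z (m + i)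

lemma sum_ff {n : ℕ} (m j : ℕ) (c : ℝ) (z : Fin n → ℝ) :
    ∑ i ∈ Finset.range (j + 1), ff m c z i = TT m j z - ((j : ℝ) + 1) * c := by
  simp [ff, TT, Finset.sum_sub_distrib]

lemma TT_continuous {n : ℕ} (m j : ℕ) : Continuous fun z : Fin n → ℝ => TT m j z :=
  continuous_finsetSum _ fun i _ => (pad_continuous (m + i)).neg

lemma memLp_TT {n : ℕ} (m j : ℕ) : MemLp (fun z : Fin n → ℝ => TT m j z) 2 (gaussVec n 1) :=
  memLp_finsetSum _ fun i _ => (memLp_pad (m + i)).neg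

lemma integral_pad {n : ℕ} (i : ℕ) : ∫ z : Fin n → ℝ, pad z i ∂gaussVec n 1 = 0 := by
  unfold pad
  split_ifs with h
  · unfold gaussVec
    rw [integral_comp_eval (μ := fun _ : Fin n => gaussianReal 0 ((1:ℝ) ^ 2).toNNReal)
      (i := ⟨i, h⟩) (f := fun x : ℝ => x) (by fun_prop)]
    exact integral_id_gaussianReal
  · simp

lemma TT_sq {n : ℕ} (m j : ℕ) (h : m + j < n) :
    ∫ z : Fin n → ℝ, TT m j z ^ 2 ∂gaussVec n 1 = (j : ℝ) + 1 := by
  have hmean : ∫ z : Fin n → ℝ, TT m j z ∂gaussVec n 1 = 0 := by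
    unfold TT
    rw [integral_finsetSum _ fun i _ => Integrable.fun_neg (integrable_pad (m + i))]
    refine Finset.sum_eq_zero fun i _ => ?_
    rw [integral_neg, integral_pad, neg_zero]
  rw [← variance_of_integral_eq_zero (TT_continuous m j).aemeasurable hmean]
  let X : Fin n → ℝ → ℝ := fun i x => (if m ≤ i.1 ∧ i.1 < m + (j + 1) then (-1) else 0) * x
  have hX : (fun z : Fin n → ℝ => TT m j z) = ∑ i : Fin n, fun z : Fin n → ℝ => X i (z i) := by
    funext z
    rw [Finset.sum_apply]
    have h1 : TT m j z = ∑ t ∈ Finset.Ico m (m + (j + 1)), -pad z t := by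
      rw [Finset.sum_Ico_eq_sum_range]; simp [TT]
    have h2 : ∀ i : Fin n, X i (z i) =
        (fun t : ℕ => if m ≤ t ∧ t < m + (j + 1) then -pad z t else 0) i.1 := by
      intro i
      simp only [X, pad]
      split_ifs <;> simp_all
    rw [h1, Finset.sum_congr rfl fun i _ => h2 i, Fin.sum_univ_eq_sum_range
      (fun t : ℕ => if m ≤ t ∧ t < m + (j + 1) then -pad z t else 0) n, ← Finset.sum_filter]
    refine Finset.sum_congr ?_ fun _ _ => rfl
    ext t
    simp only [Finset.mem_Ico, Finset.mem_filter, Finset.mem_range]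
    omega
  rw [hX]
  unfold gaussVec
  rw [variance_sum_pi (X := X)]
  · have h3 : ∀ i : Fin n, Var[X i; gaussianReal 0 ((1:ℝ) ^ 2).toNNReal] =
        (fun t : ℕ => if m ≤ t ∧ t < m + (j + 1) then (1:ℝ) else 0) i.1 := by
      intro i
      simp only [X]
      rw [variance_const_mul]
      have := variance_id_gaussianReal (μ := 0) (v := ((1:ℝ) ^ 2).toNNReal)
      change _ * Var[id; _] = _
      rw [this]
      split_ifs <;> simp
    rw [Finset.sum_congr rfl fun i _ => h3 i, Fin.sum_univ_eq_sum_range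
      (fun t : ℕ => if m ≤ t ∧ t < m + (j + 1) then (1:ℝ) else 0) n, ← Finset.sum_filter]
    have : (Finset.range n).filter (fun t => m ≤ t ∧ t < m + (j + 1)) =
        Finset.Ico m (m + (j + 1)) := by
      ext t
      simp only [Finset.mem_Ico, Finset.mem_filter, Finset.mem_range]
      omega
    rw [this]
    simp
  · intro i
    exact (memLp_id_gaussianReal' 2 (by norm_num)).const_mul _

lemma TT_neg {n : ℕ} (m j : ℕ) (z : Fin n → ℝ) : TT m j (fun i => (-1) * z i) = -TT m j z := by
  unfold TT
  rw [← Finset.sum_neg_distrib]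
  refine Finset.sum_congr rfl fun i _ => ?_
  simp only [pad]
  split_ifs <;> simp

lemma integrable_maxsq {n : ℕ} (m j : ℕ) (b : ℝ) (hb : 0 ≤ b) :
    Integrable (fun z : Fin n → ℝ => (max (TT m j z - b) 0) ^ 2) (gaussVec n 1) := by
  refine (memLp_TT m j).integrable_sq.mono'
    (by have := TT_continuous (n := n) m j; exact Continuous.aestronglyMeasurable (by fun_prop)) ?_
  filter_upwards with z
  rw [Real.norm_eq_abs, abs_of_nonneg (sq_nonneg _)]
  rcases le_total (TT m j z - b) 0 with h | h
  · rw [max_eq_right h]; nlinarith [sq_nonneg (TT m j z)]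
  · rw [max_eq_left h]; nlinarith

lemma TT_pos_sq {n : ℕ} (m j : ℕ) (h : m + j < n) :
    ∫ z : Fin n → ℝ, (max (TT m j z) 0) ^ 2 ∂gaussVec n 1 = ((j : ℝ) + 1) / 2 := by
  have hc := TT_continuous (n := n) m j
  have h1 : ∫ z : Fin n → ℝ, (max (TT m j z) 0) ^ 2 ∂gaussVec n 1 =
      ∫ z : Fin n → ℝ, (max (-TT m j z) 0) ^ 2 ∂gaussVec n 1 := by
    have e := integral_gauss_scale (n := n) (-1) (fun z => (max (TT m j z) 0) ^ 2) (by fun_prop)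
    have e2 : gaussVec n (-1) = gaussVec n 1 := by unfold gaussVec; norm_num
    rw [e2] at e
    simpa only [TT_neg] using e
  have i1 := integrable_maxsq (n := n) m j 0 le_rfl
  simp only [sub_zero] at i1
  have h2 : ∫ z : Fin n → ℝ, TT m j z ^ 2 - (max (TT m j z) 0) ^ 2 ∂gaussVec n 1 =
      ∫ z : Fin n → ℝ, (max (-TT m j z) 0) ^ 2 ∂gaussVec n 1 := by
    congr 1
    funext z
    rcases le_total (TT m j z) 0 with h | h
    · rw [max_eq_right h, max_eq_left (by linarith)]; ring
    · rw [max_eq_left h, max_eq_right (by linarith)]; ring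
  rw [integral_sub (memLp_TT m j).integrable_sq i1, TT_sq m j h] at h2
  linarith

lemma tail_tendsto {n : ℕ} (m j : ℕ) :
    Filter.Tendsto (fun L : ℝ => ∫ z : Fin n → ℝ, (max (TT m j z - ((j : ℝ) + 1) * L) 0) ^ 2
      ∂gaussVec n 1) Filter.atTop (nhds 0) := by
  have hc := TT_continuous (n := n) m j
  have : ∫ z : Fin n → ℝ, (0:ℝ) ∂gaussVec n 1 = 0 := by simp
  refine Eq.subst (motive := fun w => Filter.Tendsto _ _ (nhds w)) this ?_
  refine tendsto_integral_filter_of_dominated_convergence (fun z => TT m j z ^ 2) ?_ ?_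
    (memLp_TT m j).integrable_sq ?_
  · filter_upwards with L
    exact Continuous.aestronglyMeasurable (by fun_prop)
  · filter_upwards [Filter.eventually_ge_atTop 0] with L hL
    filter_upwards with z
    have hb : 0 ≤ ((j : ℝ) + 1) * L := by positivity
    rw [Real.norm_eq_abs, abs_of_nonneg (sq_nonneg _)]
    rcases le_total (TT m j z - ((j : ℝ) + 1) * L) 0 with h | h
    · rw [max_eq_right h]; nlinarith [sq_nonneg (TT m j z)]
    · rw [max_eq_left h]; nlinarith
  · filter_upwards with z
    refine tendsto_const_nhds.congr' ?_
    filter_upwards [Filter.eventually_ge_atTop (|TT m j z|)] with L hL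
    have h0 := abs_nonneg (TT m j z)
    have h1 := le_abs_self (TT m j z)
    have h2 : (0:ℝ) ≤ j := by positivity
    rw [max_eq_right (by nlinarith)]; norm_num

/-- The lower bound functional. -/
def Phi (n m k : ℕ) (L : ℝ) : ℝ := ∑ j ∈ Finset.range k, 1 / ((j : ℝ) + 1) *
  ∫ z : Fin n → ℝ, ((max (TT m j z) 0) ^ 2 - (max (TT m j z - ((j : ℝ) + 1) * L) 0) ^ 2) /
    (2 * ((j : ℝ) + 1)) ∂gaussVec n 1

lemma Phi_tendsto (n m k : ℕ) (h : m + k ≤ n) :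
    Filter.Tendsto (Phi n m k) Filter.atTop (nhds ((harmonic k : ℝ) / 4)) := by
  have hH : (harmonic k : ℝ) / 4 = ∑ j ∈ Finset.range k, 1 / ((j : ℝ) + 1) * ((((j : ℝ) + 1) / 2 - 0) /
      (2 * ((j : ℝ) + 1))) := by
    rw [harmonic]
    push_cast
    rw [Finset.sum_div]
    refine Finset.sum_congr rfl fun j _ => ?_
    have : ((j : ℝ) + 1) ≠ 0 := by positivity
    field_simp
    norm_num
    ring
  rw [hH]
  refine tendsto_finsetSum _ fun j hj => ?_
  refine Filter.Tendsto.const_mul _ ?_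
  have hj' := Finset.mem_range.mp hj
  have ht := ((tail_tendsto (n := n) m j).const_sub (((j : ℝ) + 1) / 2)).div_const
    (2 * ((j : ℝ) + 1))
  refine ht.congr' ?_
  filter_upwards [Filter.eventually_ge_atTop 0] with L hL
  have i1 := integrable_maxsq (n := n) m j 0 le_rfl
  simp only [sub_zero] at i1
  rw [integral_div, integral_sub i1 (integrable_maxsq m j _ (by positivity)),
    TT_pos_sq m j (by omega)]

lemma integrable_prod_aux {n : ℕ} (m k : ℕ) (L : ℝ) (F : ℝ → (Fin n → ℝ) → ℝ)
    (hF : Continuous (Function.uncurry F))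
    (hb : ∀ c z, |F c z| ≤ ∑ t ∈ Finset.range k, |ff m c z t|) :
    Integrable (Function.uncurry F) ((volume.restrict (Set.uIoc 0 L)).prod (gaussVec n 1)) := by
  have hc : Integrable (fun c : ℝ => |c|) (volume.restrict (Set.uIoc 0 L)) := by
    have := (continuous_abs (G := ℝ)).intervalIntegrable (μ := volume) 0 L
    exact (intervalIntegrable_iff.mp this)
  have : IsFiniteMeasure ((volume : Measure ℝ).restrict (Set.uIoc 0 L)) := by
    unfold Set.uIoc; infer_instance
  refine Integrable.mono' (g := fun p : ℝ × (Fin n → ℝ) =>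
    ∑ t ∈ Finset.range k, (|pad p.2 (m + t)| + |p.1|)) ?_ hF.aestronglyMeasurable ?_
  · refine integrable_finsetSum _ fun t _ => ?_
    exact ((integrable_pad (n := n) (m + t)).abs.comp_snd _).add (hc.comp_fst _)
  · filter_upwards with p
    refine (hb p.1 p.2).trans (Finset.sum_le_sum fun t _ => ?_)
    unfold ff
    calc |(-pad p.2 (m + t)) - p.1| ≤ |(-pad p.2 (m + t))| + |p.1| := abs_sub _ _
      _ = _ := by rw [abs_neg]

lemma fub_Mx {n : ℕ} (m k : ℕ) (L : ℝ) :
    Integrable (Function.uncurry fun (c : ℝ) (z : Fin n → ℝ) => Mx k (ff m c z))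
      ((volume.restrict (Set.uIoc 0 L)).prod (gaussVec n 1)) := by
  refine integrable_prod_aux m k L _ ?_ ?_
  · exact Mx_continuous k (fun p : ℝ × (Fin n → ℝ) => ff m p.1 p.2)
      (fun i => (ff_continuous m i).comp continuous_swap)
  · intro c z
    rw [abs_of_nonneg (Mx_nonneg _ _)]; exact Mx_le_abs _ _

lemma fub_max {n : ℕ} (m j : ℕ) (L : ℝ) :
    Integrable (Function.uncurry fun (c : ℝ) (z : Fin n → ℝ) =>
      max (∑ i ∈ Finset.range (j + 1), ff m c z i) 0)
      ((volume.restrict (Set.uIoc 0 L)).prod (gaussVec n 1)) := by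
  refine integrable_prod_aux m (j + 1) L _ ?_ ?_
  · refine Continuous.max ?_ continuous_const
    exact continuous_finsetSum _ fun i _ => (ff_continuous m i).comp continuous_swap
  · intro c z
    rw [abs_of_nonneg (le_max_right _ _)]
    exact max_le ((le_abs_self _).trans (Finset.abs_sum_le_sum_abs _ _))
      (Finset.sum_nonneg fun _ _ => abs_nonneg _)

lemma Phi_le {n : ℕ} (m k : ℕ) (L : ℝ) (hL : 0 ≤ L) (h : m + k ≤ n) :
    Phi n m k L ≤ ∫ z, (∫ c in (0:ℝ)..L, Mx k (ff m c z)) ∂gaussVec n 1 := by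
  rw [← intervalIntegral_integral_swap (fub_Mx m k L)]
  have hint : ∀ j, IntervalIntegrable (fun c => ∫ z : Fin n → ℝ,
      max (∑ i ∈ Finset.range (j + 1), ff m c z i) 0 ∂gaussVec n 1) volume 0 L := by
    intro j
    rw [intervalIntegrable_iff]
    exact (fub_max (n := n) m j L).integral_prod_left
  have hPhi : Phi n m k L = ∫ c in (0:ℝ)..L, ∑ j ∈ Finset.range k, 1 / ((j : ℝ) + 1) *
      ∫ z : Fin n → ℝ, max (∑ i ∈ Finset.range (j + 1), ff m c z i) 0 ∂gaussVec n 1 := by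
    rw [intervalIntegral.integral_finsetSum fun j _ => (hint j).const_mul _]
    unfold Phi
    refine Finset.sum_congr rfl fun j _ => ?_
    rw [intervalIntegral.integral_const_mul, intervalIntegral_integral_swap (fub_max m j L)]
    congr 2
    funext z
    simp_rw [sum_ff]
    rw [integral_max _ _ _ (by positivity)]
  rw [hPhi]
  refine intervalIntegral.integral_mono_on hL ?_ ?_ fun c _ => spitzer m k c h
  · have := IntervalIntegrable.sum (Finset.range k)
      fun j (_ : j ∈ Finset.range k) => (hint j).const_mul (1 / ((j : ℝ) + 1))
    refine Eq.subst (motive := fun w => IntervalIntegrable w volume 0 L) ?_ this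
    funext c
    rw [Finset.sum_apply]
  · rw [intervalIntegrable_iff]
    exact (fub_Mx (n := n) m k L).integral_prod_left

lemma mem_K {n : ℕ} (θ : Fin n → ℝ) : θ ∈ Kset 1 n 1 ↔
    ∑ t ∈ Finset.range (n - 1), |pad θ (t + 1) - pad θ t| ≤ 1 := by
  change Dl1 1 θ ≤ _ ↔ _
  simp [Dl1, DD, dseq]

lemma K_convex {n : ℕ} (p θ : Fin n → ℝ) (hp : p ∈ Kset 1 n 1) (hθ : θ ∈ Kset 1 n 1)
    (s : ℝ) (h0 : 0 ≤ s) (h1 : s ≤ 1) : (fun i => p i + s * (θ i - p i)) ∈ Kset 1 n 1 := by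
  rw [mem_K] at *
  have hpad : ∀ t, pad (fun i => p i + s * (θ i - p i)) t = (1 - s) * pad p t + s * pad θ t := by
    intro t
    simp only [pad]
    split_ifs
    · ring
    · ring
  calc _ ≤ ∑ t ∈ Finset.range (n - 1), ((1 - s) * |pad p (t + 1) - pad p t| +
        s * |pad θ (t + 1) - pad θ t|) := by
        refine Finset.sum_le_sum fun t _ => ?_
        rw [hpad, hpad]
        have e : (1 - s) * pad p (t + 1) + s * pad θ (t + 1) - ((1 - s) * pad p t + s * pad θ t) =
          (1 - s) * (pad p (t + 1) - pad p t) + s * (pad θ (t + 1) - pad θ t) := by ring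
        rw [e]
        refine (abs_add_le _ _).trans ?_
        rw [abs_mul, abs_mul, abs_of_nonneg h0, abs_of_nonneg (sub_nonneg.mpr h1)]
    _ = (1 - s) * ∑ t ∈ Finset.range (n - 1), |pad p (t + 1) - pad p t| +
        s * ∑ t ∈ Finset.range (n - 1), |pad θ (t + 1) - pad θ t| := by
        rw [Finset.sum_add_distrib, Finset.mul_sum, Finset.mul_sum]
    _ ≤ 1 := by nlinarith

lemma proj_vi {n : ℕ} (est : (Fin n → ℝ) → Fin n → ℝ) (hest : IsProjOn est (Kset 1 n 1))
    (y θ : Fin n → ℝ) (hθ : θ ∈ Kset 1 n 1) :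
    ∑ i, (y i - est y i) * (θ i - est y i) ≤ 0 := by
  set I := ∑ i, (y i - est y i) * (θ i - est y i) with hI
  set Q := ∑ i, (θ i - est y i) ^ 2 with hQ
  have hQ0 : 0 ≤ Q := Finset.sum_nonneg fun _ _ => sq_nonneg _
  have key : ∀ s : ℝ, 0 < s → s ≤ 1 → 2 * I ≤ s * Q := by
    intro s h0 h1
    have h := (hest y).2 _ (K_convex _ θ (hest y).1 hθ s h0.le h1)
    have e : sqnorm (y - fun i => est y i + s * (θ i - est y i)) =
        sqnorm (y - est y) - 2 * s * I + s ^ 2 * Q := by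
      simp only [sqnorm, hI, hQ, Finset.mul_sum, Pi.sub_apply]
      rw [← Finset.sum_sub_distrib, ← Finset.sum_add_distrib]
      exact Finset.sum_congr rfl fun i _ => by ring
    rw [e] at h
    have : s * (2 * I) ≤ s * (s * Q) := by nlinarith
    exact le_of_mul_le_mul_left this h0
  by_contra hneg
  push Not at hneg
  have h1 := key (min 1 (I / (Q + 1))) (lt_min one_pos (by positivity)) (min_le_left _ _)
  have h2 : min 1 (I / (Q + 1)) * Q ≤ I / (Q + 1) * Q :=
    mul_le_mul_of_nonneg_right (min_le_right _ _) hQ0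
  have h3 : I / (Q + 1) * Q ≤ I := by
    rw [div_mul_eq_mul_div, div_le_iff₀ (by positivity)]; nlinarith
  linarith

lemma proj_nonexp {n : ℕ} (est : (Fin n → ℝ) → Fin n → ℝ) (hest : IsProjOn est (Kset 1 n 1))
    (y w : Fin n → ℝ) : sqnorm (est y - est w) ≤ sqnorm (y - w) := by
  have h1 := proj_vi est hest y (est w) (hest w).1
  have h2 := proj_vi est hest w (est y) (hest y).1
  have h3 : sqnorm (y - w) - sqnorm (est y - est w) +
      2 * (∑ i, (y i - est y i) * (est w i - est y i) +
        ∑ i, (w i - est w i) * (est y i - est w i)) =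
      ∑ i, ((y i - w i) - (est y i - est w i)) ^ 2 := by
    simp only [sqnorm, Pi.sub_apply]
    rw [← Finset.sum_add_distrib, Finset.mul_sum, ← Finset.sum_sub_distrib,
      ← Finset.sum_add_distrib]
    exact Finset.sum_congr rfl fun i _ => by ring
  have h4 : 0 ≤ ∑ i, ((y i - w i) - (est y i - est w i)) ^ 2 :=
    Finset.sum_nonneg fun _ _ => sq_nonneg _
  linarith

lemma sqnorm_continuous {n : ℕ} : Continuous (sqnorm (n := n)) := by
  unfold sqnorm; fun_prop

lemma est_continuous {n : ℕ} (est : (Fin n → ℝ) → Fin n → ℝ)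
    (hest : IsProjOn est (Kset 1 n 1)) : Continuous est := by
  refine continuous_pi fun i => continuous_iff_continuousAt.mpr fun w => ?_
  rw [ContinuousAt, tendsto_iff_norm_sub_tendsto_zero]
  have hc : Continuous fun y : Fin n → ℝ => Real.sqrt (sqnorm (y - w)) :=
    (sqnorm_continuous.comp (continuous_id.sub continuous_const)).sqrt
  have ht := hc.tendsto w
  simp only [sub_self] at ht
  rw [show Real.sqrt (sqnorm (0 : Fin n → ℝ)) = 0 by simp [sqnorm]] at ht
  refine squeeze_zero (fun _ => norm_nonneg _) (fun y => ?_) ht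
  rw [Real.norm_eq_abs]
  refine Real.abs_le_sqrt ((?_ : _ ≤ sqnorm (est y - est w)).trans (proj_nonexp est hest y w))
  exact Finset.single_le_sum (f := fun i => (est y - est w) i ^ 2)
    (fun _ _ => sq_nonneg _) (Finset.mem_univ i)

/-- step vector with step at position `l` -/
def stepv (n l : ℕ) : Fin n → ℝ := fun i => if i.1 < l then 0 else 1

lemma stepv_mem (n l : ℕ) : stepv n l ∈ Kset 1 n 1 := by
  rw [mem_K]
  calc _ ≤ ∑ t ∈ Finset.range (n - 1), if t = l - 1 then (1:ℝ) else 0 := by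
        refine Finset.sum_le_sum fun t ht => ?_
        have := Finset.mem_range.mp ht
        simp only [pad, stepv]
        rw [dif_pos (by omega), dif_pos (by omega)]
        split_ifs <;> first | omega | norm_num
    _ ≤ 1 := by
        rw [Finset.sum_ite_eq']
        split_ifs <;> norm_num

lemma sum_block {n : ℕ} (m i : ℕ) (h : m + i ≤ n) (g : Fin n → ℝ) :
    ∑ t ∈ Finset.range i, pad g (m + t) =
      ∑ a : Fin n, if m ≤ a.1 ∧ a.1 < m + i then g a else 0 := by
  have h2 : ∀ a : Fin n, (if m ≤ a.1 ∧ a.1 < m + i then g a else 0) =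
      (fun t : ℕ => if m ≤ t ∧ t < m + i then pad g t else 0) a.1 := by
    intro a; simp [pad]
  rw [Finset.sum_congr rfl fun a _ => h2 a, Fin.sum_univ_eq_sum_range
    (fun t : ℕ => if m ≤ t ∧ t < m + i then pad g t else 0) n, ← Finset.sum_filter]
  have h1 := Finset.sum_Ico_eq_sum_range (pad g) m (m + i)
  rw [Nat.add_sub_cancel_left] at h1
  rw [← h1]
  refine Finset.sum_congr ?_ fun _ _ => rfl
  ext t
  simp only [Finset.mem_Ico, Finset.mem_filter, Finset.mem_range]
  omega

lemma vi_block {n : ℕ} (est : (Fin n → ℝ) → Fin n → ℝ) (hest : IsProjOn est (Kset 1 n 1))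
    (m i : ℕ) (h : m + i ≤ n) (ξ : Fin n → ℝ) :
    ∑ t ∈ Finset.range i, -pad ξ (m + t) ≤
      ∑ t ∈ Finset.range i, -pad (est (stepv n m + ξ) - stepv n m) (m + t) + sqnorm ξ / 4 := by
  have hv := proj_vi est hest (stepv n m + ξ) (stepv n (m + i)) (stepv_mem n (m + i))
  set x := est (stepv n m + ξ) - stepv n m with hx
  have e : est (stepv n m + ξ) = stepv n m + x := by rw [hx]; abel
  rw [e] at hv
  rw [Finset.sum_neg_distrib, Finset.sum_neg_distrib, sum_block m i h, sum_block m i h]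
  have hb : sqnorm ξ / 4 - ∑ a : Fin n, (ξ a - x a) * x a = ∑ a, (ξ a / 2 - x a) ^ 2 := by
    unfold sqnorm
    rw [Finset.sum_div, ← Finset.sum_sub_distrib]
    exact Finset.sum_congr rfl fun a _ => by ring
  have hb0 : 0 ≤ ∑ a, (ξ a / 2 - x a) ^ 2 := Finset.sum_nonneg fun _ _ => sq_nonneg _
  have hc : ∑ a : Fin n, ((stepv n m + ξ) a - (stepv n m + x) a) *
      (stepv n (m + i) a - (stepv n m + x) a) =
      (∑ a : Fin n, if m ≤ a.1 ∧ a.1 < m + i then x a else 0) -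
      (∑ a : Fin n, if m ≤ a.1 ∧ a.1 < m + i then ξ a else 0) -
      ∑ a : Fin n, (ξ a - x a) * x a := by
    rw [← Finset.sum_sub_distrib, ← Finset.sum_sub_distrib]
    refine Finset.sum_congr rfl fun a _ => ?_
    simp only [Pi.add_apply, stepv]
    split_ifs <;> first | omega | ring
  linarith

lemma Mx_bound {n : ℕ} (est : (Fin n → ℝ) → Fin n → ℝ) (hest : IsProjOn est (Kset 1 n 1))
    (m k : ℕ) (h : m + k ≤ n) (z : Fin n → ℝ) (σ : ℝ) (hσ : 0 < σ) (c : ℝ) (hc : 0 ≤ c) :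
    Mx k (ff m c z) ≤
      ∑ t ∈ Finset.range k,
        max (-pad (est (stepv n m + fun i => σ * z i) - stepv n m) (m + t) / σ - 1 * c) 0 +
      σ * sqnorm z / 4 := by
  refine Mx_le _ _ _ fun i hi => ?_
  have hv := vi_block est hest m i (by omega) (fun i => σ * z i)
  set x := est (stepv n m + fun i => σ * z i) - stepv n m with hx
  have h1 : ∀ t, pad (fun i => σ * z i) t = σ * pad z t := by
    intro t; simp only [pad]; split_ifs <;> simp
  have h2 : sqnorm (fun i => σ * z i) = σ ^ 2 * sqnorm z := by
    simp only [sqnorm, mul_pow, Finset.mul_sum]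
  simp_rw [h1] at hv
  rw [h2] at hv
  have h3 : ∑ t ∈ Finset.range i, -(σ * pad z (m + t)) =
      σ * ∑ t ∈ Finset.range i, -pad z (m + t) := by
    rw [Finset.mul_sum]; exact Finset.sum_congr rfl fun _ _ => by ring
  have h4 : ∑ t ∈ Finset.range i, -pad x (m + t) =
      σ * ∑ t ∈ Finset.range i, -pad x (m + t) / σ := by
    rw [Finset.mul_sum]; exact Finset.sum_congr rfl fun _ _ => by field_simp
  rw [h3, h4] at hv
  have h5 : ∑ t ∈ Finset.range i, -pad z (m + t) ≤
      ∑ t ∈ Finset.range i, -pad x (m + t) / σ + σ * sqnorm z / 4 := by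
    refine le_of_mul_le_mul_left (hv.trans (le_of_eq ?_)) hσ
    ring
  have h6 : ∑ t ∈ Finset.range i, (-pad x (m + t) / σ - 1 * c) ≤
      ∑ t ∈ Finset.range k, max (-pad x (m + t) / σ - 1 * c) 0 :=
    (Finset.sum_le_sum fun t _ => le_max_left _ _).trans
      (Finset.sum_le_sum_of_subset_of_nonneg (by simpa using hi) fun _ _ _ => le_max_right _ _)
  have h7 : ∑ t ∈ Finset.range i, ff m c z t =
      ∑ t ∈ Finset.range i, -pad z (m + t) - i * c := by
    simp [ff, Finset.sum_sub_distrib]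
  have h8 : ∑ t ∈ Finset.range i, (-pad x (m + t) / σ - 1 * c) =
      ∑ t ∈ Finset.range i, -pad x (m + t) / σ - i * c := by
    simp [Finset.sum_sub_distrib]
  linarith

lemma intMx_bound {n : ℕ} (est : (Fin n → ℝ) → Fin n → ℝ) (hest : IsProjOn est (Kset 1 n 1))
    (m k : ℕ) (h : m + k ≤ n) (z : Fin n → ℝ) (σ : ℝ) (hσ : 0 < σ) (L : ℝ) (hL : 0 ≤ L) :
    ∫ c in (0:ℝ)..L, Mx k (ff m c z) ≤
      sqnorm (est (stepv n m + fun i => σ * z i) - stepv n m) / σ ^ 2 / 2 +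
      L * (σ * sqnorm z / 4) := by
  set x := est (stepv n m + fun i => σ * z i) - stepv n m with hx
  have hi : ∀ t, IntervalIntegrable (fun c : ℝ => max (-pad x (m + t) / σ - 1 * c) 0)
      volume 0 L := fun t => Continuous.intervalIntegrable (by fun_prop) _ _
  have hi2 : IntervalIntegrable (fun c : ℝ => ∑ t ∈ Finset.range k,
      max (-pad x (m + t) / σ - 1 * c) 0) volume 0 L :=
    Continuous.intervalIntegrable (by fun_prop) _ _
  calc _ ≤ ∫ c in (0:ℝ)..L, (∑ t ∈ Finset.range k, max (-pad x (m + t) / σ - 1 * c) 0 +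
      σ * sqnorm z / 4) := by
        refine intervalIntegral.integral_mono_on hL ?_ (hi2.add intervalIntegrable_const)
          fun c hc => Mx_bound est hest m k h z σ hσ c hc.1
        refine Continuous.intervalIntegrable (Mx_continuous k _ fun i => ?_) _ _
        unfold ff; fun_prop
    _ = ∑ t ∈ Finset.range k, ((max (-pad x (m + t) / σ) 0) ^ 2 -
          (max (-pad x (m + t) / σ - 1 * L) 0) ^ 2) / (2 * 1) + L * (σ * sqnorm z / 4) := by
        rw [intervalIntegral.integral_add hi2 intervalIntegrable_const,
          intervalIntegral.integral_finsetSum fun t _ => hi t]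
        congr 1
        · exact Finset.sum_congr rfl fun t _ => integral_max 1 _ L one_pos
        · rw [intervalIntegral.integral_const, sub_zero, smul_eq_mul]
    _ ≤ _ := by
        gcongr
        have hs : ∑ t ∈ Finset.range k, pad (fun i => x i ^ 2) (m + t) ≤ sqnorm x := by
          rw [sum_block m k h]
          unfold sqnorm
          refine Finset.sum_le_sum fun a _ => ?_
          split_ifs
          · exact le_rfl
          · positivity
        have hp : ∀ t, pad (fun i => x i ^ 2) t = pad x t ^ 2 := by
          intro t; simp only [pad]; split_ifs <;> simp
        simp_rw [hp] at hs
        calc _ ≤ ∑ t ∈ Finset.range k, pad x (m + t) ^ 2 / σ ^ 2 / 2 := by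
              refine Finset.sum_le_sum fun t _ => ?_
              rw [mul_one]
              gcongr
              rw [← div_pow]
              have h1 : (max (-pad x (m + t) / σ) 0) ^ 2 ≤ (pad x (m + t) / σ) ^ 2 := by
                rw [neg_div]
                rcases le_total (-(pad x (m + t) / σ)) 0 with h | h
                · rw [max_eq_right h]; nlinarith [sq_nonneg (pad x (m + t) / σ)]
                · rw [max_eq_left h]; nlinarith
              linarith [sq_nonneg (max (-pad x (m + t) / σ - 1 * L) 0)]
          _ = (∑ t ∈ Finset.range k, pad x (m + t) ^ 2) / σ ^ 2 / 2 := by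
              rw [Finset.sum_div, Finset.sum_div]
          _ ≤ _ := by gcongr

lemma sqnorm_pad {n : ℕ} (z : Fin n → ℝ) : sqnorm z = ∑ i ∈ Finset.range n, TT i 0 z ^ 2 := by
  rw [← Fin.sum_univ_eq_sum_range (fun i => TT i 0 z ^ 2) n]
  unfold sqnorm
  refine Finset.sum_congr rfl fun i _ => ?_
  simp [TT, pad]

lemma integrable_sqnorm (n : ℕ) : Integrable (fun z : Fin n → ℝ => sqnorm z) (gaussVec n 1) := by
  simp_rw [sqnorm_pad]
  exact integrable_finsetSum _ fun i _ => (memLp_TT i 0).integrable_sq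

lemma integral_sqnorm (n : ℕ) : ∫ z : Fin n → ℝ, sqnorm z ∂gaussVec n 1 = n := by
  simp_rw [sqnorm_pad]
  rw [integral_finsetSum _ fun i _ => (memLp_TT i 0).integrable_sq,
    Finset.sum_congr rfl fun i hi => TT_sq i 0 (by simpa using hi)]
  simp

lemma est_bound {n : ℕ} (est : (Fin n → ℝ) → Fin n → ℝ) (hest : IsProjOn est (Kset 1 n 1))
    (m : ℕ) (z : Fin n → ℝ) (σ : ℝ) (hσ : 0 < σ) :
    sqnorm (est (stepv n m + fun i => σ * z i) - stepv n m) / σ ^ 2 ≤ sqnorm z := by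
  have h0 : est (stepv n m) = stepv n m := by
    have h := (hest (stepv n m)).2 _ (stepv_mem n m)
    rw [sub_self, show sqnorm (0 : Fin n → ℝ) = 0 by simp [sqnorm]] at h
    funext i
    have h1 : (stepv n m i - est (stepv n m) i) ^ 2 ≤ 0 :=
      (Finset.single_le_sum (f := fun i => (stepv n m - est (stepv n m)) i ^ 2)
        (fun _ _ => sq_nonneg _) (Finset.mem_univ i)).trans h
    nlinarith [sq_nonneg (stepv n m i - est (stepv n m) i)]
  have h := proj_nonexp est hest (stepv n m + fun i => σ * z i) (stepv n m)
  rw [h0, add_sub_cancel_left] at h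
  have h2 : sqnorm (fun i => σ * z i) = σ ^ 2 * sqnorm z := by
    simp only [sqnorm, mul_pow, Finset.mul_sum]
  rw [h2] at h
  rw [div_le_iff₀ (by positivity)]
  linarith

lemma risk_eq {n : ℕ} (est : (Fin n → ℝ) → Fin n → ℝ) (hest : IsProjOn est (Kset 1 n 1))
    (m : ℕ) (σ : ℝ) : 1 / σ ^ 2 * risk σ est (stepv n m) =
      1 / (n : ℝ) * ∫ z, sqnorm (est (stepv n m + fun i => σ * z i) - stepv n m) / σ ^ 2
        ∂gaussVec n 1 := by
  unfold risk
  have := est_continuous est hest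
  have := sqnorm_continuous (n := n)
  rw [integral_gauss_scale σ (fun ξ => sqnorm (est (stepv n m + ξ) - stepv n m)) (by fun_prop),
    integral_div]
  ring

lemma integrable_x {n : ℕ} (est : (Fin n → ℝ) → Fin n → ℝ) (hest : IsProjOn est (Kset 1 n 1))
    (m : ℕ) (σ : ℝ) (hσ : 0 < σ) : Integrable (fun z : Fin n → ℝ =>
      sqnorm (est (stepv n m + fun i => σ * z i) - stepv n m) / σ ^ 2) (gaussVec n 1) := by
  have h1 := est_continuous est hest
  have h2 := sqnorm_continuous (n := n)
  refine (integrable_sqnorm n).mono' ?_ ?_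
  · have : Continuous fun z : Fin n → ℝ =>
        sqnorm (est (stepv n m + fun i => σ * z i) - stepv n m) := by fun_prop
    exact (this.div_const _).aestronglyMeasurable
  · filter_upwards with z
    rw [Real.norm_eq_abs, abs_of_nonneg
      (div_nonneg (Finset.sum_nonneg fun _ _ => sq_nonneg _) (sq_nonneg _))]
    exact est_bound est hest m z σ hσ

lemma risk_lower {n : ℕ} (hn : 0 < n) (est : (Fin n → ℝ) → Fin n → ℝ)
    (hest : IsProjOn est (Kset 1 n 1)) (m k : ℕ) (h : m + k ≤ n) (σ : ℝ) (hσ : 0 < σ)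
    (L : ℝ) (hL : 0 ≤ L) :
    2 / (n : ℝ) * Phi n m k L - L * σ / 2 ≤ 1 / σ ^ 2 * risk σ est (stepv n m) := by
  rw [risk_eq est hest]
  have hn' : (0:ℝ) < n := by exact_mod_cast hn
  have ix := integrable_x est hest m σ hσ
  have iz := integrable_sqnorm n
  have i2 : Integrable (fun z : Fin n → ℝ => L * (σ * sqnorm z / 4)) (gaussVec n 1) :=
    ((iz.const_mul σ).div_const 4).const_mul L
  have h1 := Phi_le (n := n) m k L hL h
  have hMi : Integrable (fun z : Fin n → ℝ => ∫ c in (0:ℝ)..L, Mx k (ff m c z))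
      (gaussVec n 1) := by
    have := (fub_Mx (n := n) m k L).integral_prod_right
    simpa only [intervalIntegral.integral_of_le hL, Set.uIoc_of_le hL, Function.uncurry] using this
  have h2 := integral_mono hMi ((ix.div_const 2).add i2)
    fun z => intMx_bound est hest m k h z σ hσ L hL
  have h3 := integral_add (ix.div_const 2) i2
  have h4 : ∫ z : Fin n → ℝ, L * (σ * sqnorm z / 4) ∂gaussVec n 1 = L * (σ * n / 4) := by
    rw [integral_const_mul, integral_div, integral_const_mul, integral_sqnorm]
  rw [integral_div, h4] at h3
  have h5 := h1.trans (h2.trans (le_of_eq h3))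
  set J := ∫ z, sqnorm (est (stepv n m + fun i => σ * z i) - stepv n m) / σ ^ 2 ∂gaussVec n 1
  have h6 : 2 / (n : ℝ) * Phi n m k L ≤ 2 / (n : ℝ) * (J / 2 + L * (σ * n / 4)) :=
    mul_le_mul_of_nonneg_left h5 (by positivity)
  have h7 : 2 / (n : ℝ) * (J / 2 + L * (σ * n / 4)) = 1 / (n : ℝ) * J + L * σ / 2 := by
    field_simp
    ring
  linarith

lemma risk_upper {n : ℕ} (hn : 0 < n) (est : (Fin n → ℝ) → Fin n → ℝ)
    (hest : IsProjOn est (Kset 1 n 1)) (m : ℕ) (σ : ℝ) (hσ : 0 < σ) :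
    1 / σ ^ 2 * risk σ est (stepv n m) ≤ 1 := by
  rw [risk_eq est hest]
  have hn' : (0:ℝ) < n := by exact_mod_cast hn
  have h := integral_mono (integrable_x est hest m σ hσ) (integrable_sqnorm n)
    fun z => est_bound est hest m z σ hσ
  simp only [integral_sqnorm] at h
  rw [one_div, inv_mul_le_iff₀ hn', mul_one]
  exact h

/-- Lemma: the logarithmic factor cannot be removed.  Here
`θ*_i = 0` for `i < ⌈n/2⌉` and `θ*_i = 1` for `i ≥ ⌈n/2⌉` (1-indexed positions),
and `⌈n/2⌉ = (n+1)/2` in ℕ. -/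
theorem stmt3 (n : ℕ) (hn : 2 ≤ n) (θstar : Fin n → ℝ)
    (hθ : ∀ i : Fin n, θstar i = if i.1 + 1 < (n + 1) / 2 then 0 else 1)
    (est : (Fin n → ℝ) → Fin n → ℝ) (hest : IsProjOn est (Kset 1 n 1)) :
    Real.log ((n : ℝ) / 2) / (2 * (n : ℝ)) ≤
      Filter.liminf (fun σ : ℝ => 1 / σ ^ 2 * risk σ est θstar)
        (nhdsWithin 0 (Set.Ioi (0 : ℝ))) := by
  obtain ⟨m, hm⟩ : ∃ m, m = (n + 1) / 2 - 1 := ⟨_, rfl⟩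
  have hθ' : θstar = stepv n m := by
    funext i
    rw [hθ i, stepv]
    have : (i.1 + 1 < (n + 1) / 2) ↔ i.1 < m := by omega
    simp only [this]
  subst hθ'
  have hn0 : 0 < n := by omega
  have hn' : (0:ℝ) < n := by exact_mod_cast hn0
  obtain ⟨k, hk⟩ : ∃ k, k = n - m := ⟨_, rfl⟩
  have hmk : m + k ≤ n := by omega
  have hlog : Real.log ((n : ℝ) / 2) / 4 < (harmonic k : ℝ) / 4 := by
    have h1 : Real.log ((n : ℝ) / 2) < Real.log ((k + 1 : ℕ) : ℝ) := by
      apply Real.log_lt_log (by positivity)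
      rw [div_lt_iff₀ (by norm_num)]
      have : n < (k + 1) * 2 := by omega
      exact_mod_cast this
    have := log_add_one_le_harmonic k
    linarith
  obtain ⟨L, hL1, hL0⟩ := (((Phi_tendsto n m k hmk).eventually_const_lt hlog).and
    (Filter.eventually_ge_atTop 0)).exists
  refine Filter.le_liminf_of_le ?_ ?_
  · refine Filter.IsBoundedUnder.isCoboundedUnder_ge ⟨1, ?_⟩
    rw [Filter.eventually_map]
    filter_upwards [self_mem_nhdsWithin] with σ hσ
    exact risk_upper hn0 est hest m σ hσ
  · have hlt : Real.log ((n : ℝ) / 2) / (2 * (n : ℝ)) < 2 / (n : ℝ) * Phi n m k L - L * 0 / 2 := by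
      have e : Real.log ((n : ℝ) / 2) / (2 * (n : ℝ)) =
          2 / (n : ℝ) * (Real.log ((n : ℝ) / 2) / 4) := by
        field_simp; ring
      rw [e, mul_zero, zero_div, sub_zero]
      exact mul_lt_mul_of_pos_left hL1 (by positivity)
    have ht : Filter.Tendsto (fun σ : ℝ => 2 / (n : ℝ) * Phi n m k L - L * σ / 2)
        (nhdsWithin 0 (Set.Ioi (0 : ℝ))) (nhds (2 / (n : ℝ) * Phi n m k L - L * 0 / 2)) := by
      have hc : Continuous (fun σ : ℝ => 2 / (n : ℝ) * Phi n m k L - L * σ / 2) := by fun_prop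
      exact (hc.tendsto 0).mono_left nhdsWithin_le_nhds
    filter_upwards [self_mem_nhdsWithin, ht.eventually_const_lt hlt] with σ hσ h
    exact h.le.trans (risk_lower hn0 est hest m k hmk σ hσ L hL0)
end
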